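/- (Theorem 1, first part, Hopf–Lax form.) Let J be a nonempty compact interval of ℝ, and suppose u_T is left continuous, takes values in J, and satisfies the Oleinik condition (O) at T. Then II_T(U_T; J) = { U_o : ℝ → ℝ Lipschitz : U_o'(x) ∈ J and U_o^♭(x) ≤ U_o(x) ≤ U_o^♯(x) for a.e. x ∈ ℝ }, where U_o^♯(x) := sup { U(x) : U ∈ II_T(U_T; J) }. -/

import Mathlib

open Filter MeasureTheory

/-- Condition (f): `f` is `C²`, strongly convex (`f'' > 0` everywhere), and
`f' → ∓∞` at `∓∞`. -/
def CondF (f : ℝ → ℝ) : Prop :=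
  ContDiff ℝ 2 f ∧ (∀ x, 0 < deriv (deriv f) x) ∧
    Tendsto (deriv f) atBot atBot ∧ Tendsto (deriv f) atTop atTop

/-- The Legendre transform `f*(y) = sup_x (y·x − f(x))`. -/
noncomputable def legendre (f : ℝ → ℝ) (y : ℝ) : ℝ :=
  sSup (Set.range fun x => y * x - f x)

/-- `U_T(x) = ∫_{x̌}^x u_T`. -/
noncomputable def UT (uT : ℝ → ℝ) (xc x : ℝ) : ℝ := ∫ ξ in xc..x, uT ξ

/-- `U_o^♭(x) = sup_ξ [U_T(ξ) − T f*((ξ−x)/T)]`. -/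
noncomputable def Uflat (f : ℝ → ℝ) (T : ℝ) (uT : ℝ → ℝ) (xc x : ℝ) : ℝ :=
  sSup (Set.range fun ξ => UT uT xc ξ - T * legendre f ((ξ - x) / T))

/-- `M(x)`: the set of maximizers in the definition of `U_o^♭(x)`. -/
def MSet (f : ℝ → ℝ) (T : ℝ) (uT : ℝ → ℝ) (xc x : ℝ) : Set ℝ :=
  {ξ | UT uT xc ξ = Uflat f T uT xc x + T * legendre f ((ξ - x) / T)}

/-- Oleinik condition (O) at `T`. -/
def Oleinik (f : ℝ → ℝ) (T : ℝ) (uT : ℝ → ℝ) : Prop :=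
  ∀ x Δ : ℝ, 0 < Δ → deriv f (uT (x + Δ)) - deriv f (uT x) ≤ Δ / T

/-- The Hopf–Lax operator at time `T`: `(S_T U)(x) = inf_ξ [U(ξ) + T f*((x−ξ)/T)]`. -/
noncomputable def HopfLax (f : ℝ → ℝ) (T : ℝ) (U : ℝ → ℝ) (x : ℝ) : ℝ :=
  sInf (Set.range fun ξ => U ξ + T * legendre f ((x - ξ) / T))

/-- Left continuity of a real function. -/
def LeftCts (u : ℝ → ℝ) : Prop :=
  ∀ x, Tendsto u (nhdsWithin x (Set.Iio x)) (nhds (u x))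

/-- `II_T(U_T; J)`: Lipschitz functions with a.e. derivative in `J` evolving into `U_T`
under the Hopf–Lax semigroup. -/
def IIT (f : ℝ → ℝ) (T : ℝ) (uT : ℝ → ℝ) (xc : ℝ) (J : Set ℝ) : Set (ℝ → ℝ) :=
  {U | (∃ K, LipschitzWith K U) ∧ (∀ᵐ x ∂volume, deriv U x ∈ J) ∧
    ∀ x, HopfLax f T U x = UT uT xc x}

/-- `U_o^♯(x) = sup { U(x) : U ∈ II_T(U_T; J) }`. -/
noncomputable def Usharp (f : ℝ → ℝ) (T : ℝ) (uT : ℝ → ℝ) (xc : ℝ) (J : Set ℝ) (x : ℝ) : ℝ :=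
  sSup ((fun U : ℝ → ℝ => U x) '' IIT f T uT xc J)

/-- All difference quotients of `F` lie in `[a, b]`. -/
def SlopeBetween (a b : ℝ) (F : ℝ → ℝ) : Prop :=
  ∀ x y, x ≤ y → F x + a * (y - x) ≤ F y ∧ F y ≤ F x + b * (y - x)

namespace SlopeBetween

variable {a b : ℝ} {F : ℝ → ℝ}

lemma abs_sub_le (h : SlopeBetween a b F) (x y : ℝ) :
    |F x - F y| ≤ max |a| |b| * |x - y| := by
  wlog hxy : x ≤ y generalizing x y
  · rw [abs_sub_comm, abs_sub_comm x]
    exact this y x (le_of_not_ge hxy)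
  obtain ⟨h1, h2⟩ := h x y hxy
  have hd : 0 ≤ y - x := sub_nonneg.2 hxy
  have ha : -max |a| |b| ≤ a := (neg_le_neg (le_max_left _ _)).trans (neg_abs_le a)
  have hb : b ≤ max |a| |b| := (le_abs_self b).trans (le_max_right _ _)
  rw [abs_sub_comm x, abs_of_nonneg hd, abs_le]
  constructor <;> nlinarith

lemma lipschitzWith (h : SlopeBetween a b F) : ∃ K, LipschitzWith K F :=
  ⟨⟨max |a| |b|, (abs_nonneg a).trans (le_max_left _ _)⟩, LipschitzWith.of_dist_le_mul fun x y =>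
    h.abs_sub_le x y⟩

lemma continuous (h : SlopeBetween a b F) : Continuous F :=
  let ⟨_, hK⟩ := h.lipschitzWith
  hK.continuous

lemma neg (h : SlopeBetween a b F) : SlopeBetween (-b) (-a) (fun x => -F x) := fun x y hxy => by
  obtain ⟨h1, h2⟩ := h x y hxy
  constructor <;> linarith

lemma deriv_mem_Icc (h : SlopeBetween a b F) {x : ℝ} (hx : DifferentiableAt ℝ F x) :
    deriv F x ∈ Set.Icc a b := by
  have ht := hx.hasDerivAt.hasDerivWithinAt (s := Set.Ioi x)
  rw [hasDerivWithinAt_iff_tendsto_slope' (Set.self_notMem_Ioi)] at ht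
  have hb : ∀ᶠ y in nhdsWithin x (Set.Ioi x), slope F x y ∈ Set.Icc a b := by
    filter_upwards [self_mem_nhdsWithin] with y hy
    have hy' : 0 < y - x := sub_pos.2 hy
    obtain ⟨h1, h2⟩ := h x y (le_of_lt hy)
    rw [slope_def_field, Set.mem_Icc, le_div_iff₀ hy', div_le_iff₀ hy']
    constructor <;> linarith
  exact isClosed_Icc.mem_of_tendsto ht hb

lemma of_ae_deriv {K : NNReal} (hF : LipschitzWith K F)
    (hd : ∀ᵐ x, deriv F x ∈ Set.Icc a b) : SlopeBetween a b F := fun x y hxy => by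
  have hac : AbsolutelyContinuousOnInterval F x y :=
    (hF.lipschitzOnWith (s := Set.uIcc x y)).absolutelyContinuousOnInterval
  have hint := hac.intervalIntegrable_deriv
  have hle : ∫ _ in x..y, a ≤ ∫ t in x..y, deriv F t :=
    intervalIntegral.integral_mono_ae hxy intervalIntegrable_const hint (hd.mono fun t ht => ht.1)
  have hge : ∫ t in x..y, deriv F t ≤ ∫ _ in x..y, b :=
    intervalIntegral.integral_mono_ae hxy hint intervalIntegrable_const (hd.mono fun t ht => ht.2)
  rw [hac.integral_deriv_eq_sub, intervalIntegral.integral_const, smul_eq_mul] at hle hge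
  constructor <;> linarith

/-- Existence of a minimizer in an infimal convolution with a superlinear cost. -/
lemma exists_min (h : SlopeBetween a b F) {c : ℝ → ℝ} (hc : Continuous c)
    (hco : ∀ M, ∃ C, ∀ z, M * |z| - C ≤ c z) (x : ℝ) :
    ∃ ξ, ∀ η, F ξ + c (x - ξ) ≤ F η + c (x - η) := by
  obtain ⟨C, hC⟩ := hco (max |a| |b| + 1)
  refine Continuous.exists_forall_le (by have := h.continuous; fun_prop) ?_
  have hlim : Tendsto (fun ξ : ℝ => F x - C + dist ξ x) (cocompact ℝ) atTop :=
    tendsto_atTop_add_const_left _ _ (tendsto_dist_right_cocompact_atTop x)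
  refine tendsto_atTop_mono (fun ξ => ?_) hlim
  have h1 := (abs_le.1 (h.abs_sub_le x ξ)).2
  have h2 := hC (x - ξ)
  rw [dist_comm, Real.dist_eq]
  linarith

/-- An infimal convolution that is attained inherits the slope bounds. -/
lemma of_attained (h : SlopeBetween a b F) {c S : ℝ → ℝ}
    (hle : ∀ x ξ, S x ≤ F ξ + c (x - ξ)) (hat : ∀ x, ∃ ξ, S x = F ξ + c (x - ξ)) :
    SlopeBetween a b S := fun x y hxy => by
  obtain ⟨ξ, hξ⟩ := hat x
  obtain ⟨η, hη⟩ := hat y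
  have h1 := hle y (ξ + (y - x))
  have h2 := hle x (η - (y - x))
  rw [show y - (ξ + (y - x)) = x - ξ by ring] at h1
  rw [show x - (η - (y - x)) = y - η by ring] at h2
  have h3 := (h ξ (ξ + (y - x)) (by linarith)).2
  have h4 := (h (η - (y - x)) η (by linarith)).1
  constructor <;> linarith

lemma sSup_image {s : Set (ℝ → ℝ)} (hne : s.Nonempty) (hs : ∀ G ∈ s, SlopeBetween a b G)
    (hbdd : ∀ x, BddAbove ((fun G : ℝ → ℝ => G x) '' s)) :
    SlopeBetween a b (fun x => sSup ((fun G : ℝ → ℝ => G x) '' s)) := fun x y hxy => by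
  have hle : ∀ z, ∀ G ∈ s, G z ≤ sSup ((fun G : ℝ → ℝ => G z) '' s) := fun z G hG =>
    le_csSup (hbdd z) (Set.mem_image_of_mem _ hG)
  constructor
  · rw [← le_sub_iff_add_le]
    refine csSup_le (hne.image _) ?_
    rintro _ ⟨G, hG, rfl⟩
    have := hle y G hG
    have := (hs G hG x y hxy).1
    simp only
    linarith
  · refine csSup_le (hne.image _) ?_
    rintro _ ⟨G, hG, rfl⟩
    have := hle x G hG
    have := (hs G hG x y hxy).2
    simp only
    linarith

end SlopeBetween

lemma intervalIntegrable_of_mem_Icc {u : ℝ → ℝ} (hu : Measurable u) {a b : ℝ}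
    (hub : ∀ x, u x ∈ Set.Icc a b) (x y : ℝ) : IntervalIntegrable u volume x y := by
  refine (intervalIntegrable_const (c := max |a| |b|)).mono_fun hu.aestronglyMeasurable
    (Eventually.of_forall fun t => ?_)
  simp only [Real.norm_eq_abs]
  exact (abs_le_max_abs_abs (hub t).1 (hub t).2).trans (le_abs_self _)

lemma UT_sub {u : ℝ → ℝ} (hu : ∀ x y, IntervalIntegrable u volume x y) (xc x y : ℝ) :
    UT u xc y - UT u xc x = ∫ t in x..y, u t :=
  intervalIntegral.integral_interval_sub_left (hu _ _) (hu _ _)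

lemma slopeBetween_UT {u : ℝ → ℝ} (hu : Measurable u) {a b : ℝ}
    (hub : ∀ x, u x ∈ Set.Icc a b) (xc : ℝ) : SlopeBetween a b (UT u xc) := fun x y hxy => by
  have hi := intervalIntegrable_of_mem_Icc hu hub
  have hle : ∫ _ in x..y, a ≤ ∫ t in x..y, u t :=
    intervalIntegral.integral_mono hxy intervalIntegrable_const (hi x y) fun t => (hub t).1
  have hge : ∫ t in x..y, u t ≤ ∫ _ in x..y, b :=
    intervalIntegral.integral_mono hxy (hi x y) intervalIntegrable_const fun t => (hub t).2
  rw [← UT_sub hi xc, intervalIntegral.integral_const, smul_eq_mul] at hle hge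
  constructor <;> linarith

/-- The tangent line inequality for a differentiable function with increasing derivative. -/
lemma tangent_le {f : ℝ → ℝ} (hd : Differentiable ℝ f) (hm : StrictMono (deriv f)) (p x : ℝ) :
    f p + deriv f p * (x - p) ≤ f x := by
  have hconv : ConvexOn ℝ Set.univ f := hm.monotone.convexOn_univ_of_deriv hd
  rcases lt_trichotomy p x with h | rfl | h
  · have := hconv.deriv_le_slope (Set.mem_univ p) (Set.mem_univ x) h (hd p)
    rw [slope_def_field, le_div_iff₀ (sub_pos.2 h)] at this
    linarith
  · simp
  · have := hconv.slope_le_deriv (Set.mem_univ x) (Set.mem_univ p) h (hd p)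
    rw [slope_def_field, div_le_iff₀ (sub_pos.2 h)] at this
    linarith

namespace CondF

variable {f : ℝ → ℝ}

lemma differentiable (hf : CondF f) : Differentiable ℝ f := hf.1.differentiable (by norm_num)

lemma strictMono_deriv (hf : CondF f) : StrictMono (deriv f) := strictMono_of_deriv_pos hf.2.1

lemma surjective_deriv (hf : CondF f) : Function.Surjective (deriv f) :=
  (hf.1.continuous_deriv (by norm_num)).surjective hf.2.2.2 hf.2.2.1

/-- The inverse of `f'`. -/
noncomputable def derivEquiv (hf : CondF f) : ℝ ≃o ℝ :=
  hf.strictMono_deriv.orderIsoOfSurjective _ hf.surjective_deriv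

@[simp] lemma derivEquiv_apply (hf : CondF f) (p : ℝ) : hf.derivEquiv p = deriv f p := rfl

@[simp] lemma deriv_derivEquiv_symm (hf : CondF f) (y : ℝ) : deriv f (hf.derivEquiv.symm y) = y :=
  hf.derivEquiv.apply_symm_apply y

lemma isGreatest_legendre (hf : CondF f) (y : ℝ) :
    IsGreatest (Set.range fun x => y * x - f x)
      (y * hf.derivEquiv.symm y - f (hf.derivEquiv.symm y)) := by
  refine ⟨⟨_, rfl⟩, ?_⟩
  rintro _ ⟨x, rfl⟩
  have := tangent_le hf.differentiable hf.strictMono_deriv (hf.derivEquiv.symm y) x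
  rw [hf.deriv_derivEquiv_symm] at this
  simp only
  linarith

lemma legendre_eq (hf : CondF f) (y : ℝ) :
    legendre f y = y * hf.derivEquiv.symm y - f (hf.derivEquiv.symm y) :=
  (hf.isGreatest_legendre y).csSup_eq

lemma le_legendre (hf : CondF f) (y x : ℝ) : y * x - f x ≤ legendre f y := by
  rw [hf.legendre_eq]
  exact (hf.isGreatest_legendre y).2 ⟨x, rfl⟩

lemma hasDerivAt_legendre (hf : CondF f) (y : ℝ) :
    HasDerivAt (legendre f) (hf.derivEquiv.symm y) y := by
  set g := hf.derivEquiv.symm with hg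
  have hsub : ∀ y z, g y * (z - y) ≤ legendre f z - legendre f y := fun y z => by
    have := hf.le_legendre z (g y)
    rw [hf.legendre_eq y]
    linarith
  have hgc : Tendsto g (nhdsWithin y {y}ᶜ) (nhds (g y)) :=
    (g.continuous.tendsto y).mono_left nhdsWithin_le_nhds
  rw [hasDerivAt_iff_tendsto_slope]
  have hmin : Tendsto (fun z => min (g y) (g z)) (nhdsWithin y {y}ᶜ) (nhds (g y)) := by
    simpa using (tendsto_const_nhds (x := g y)).min hgc
  have hmax : Tendsto (fun z => max (g y) (g z)) (nhdsWithin y {y}ᶜ) (nhds (g y)) := by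
    simpa using (tendsto_const_nhds (x := g y)).max hgc
  refine tendsto_of_tendsto_of_tendsto_of_le_of_le' hmin hmax ?_ ?_ <;>
    filter_upwards [self_mem_nhdsWithin] with z hz <;>
    have h1 := hsub y z <;> have h2 := hsub z y <;>
    rcases lt_or_gt_of_ne hz with h | h
  · refine min_le_of_right_le ?_
    rw [slope_comm, slope_def_field, le_div_iff₀ (sub_pos.2 h)]
    linarith
  · refine min_le_of_left_le ?_
    rw [slope_def_field, le_div_iff₀ (sub_pos.2 h)]
    linarith
  · refine le_max_of_le_left ?_
    rw [slope_comm, slope_def_field, div_le_iff₀ (sub_pos.2 h)]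
    linarith
  · refine le_max_of_le_right ?_
    rw [slope_def_field, div_le_iff₀ (sub_pos.2 h)]
    linarith

lemma hasDerivAt_cost (hf : CondF f) {T : ℝ} (hT : 0 < T) (z : ℝ) :
    HasDerivAt (fun z => T * legendre f (z / T)) (hf.derivEquiv.symm (z / T)) z := by
  have h := ((hf.hasDerivAt_legendre (z / T)).comp z ((hasDerivAt_id z).div_const T)).const_mul T
  have he : T * (hf.derivEquiv.symm (z / T) * (1 / T)) = hf.derivEquiv.symm (z / T) := by
    field_simp
  exact he ▸ h

lemma continuous_cost (hf : CondF f) {T : ℝ} (hT : 0 < T) :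
    Continuous (fun z => T * legendre f (z / T)) :=
  continuous_iff_continuousAt.2 fun z => (hf.hasDerivAt_cost hT z).continuousAt

lemma cost_coercive (hf : CondF f) {T : ℝ} (hT : 0 < T) (M : ℝ) :
    ∃ C, ∀ z, M * |z| - C ≤ T * legendre f (z / T) := by
  refine ⟨T * max (f M) (f (-M)), fun z => ?_⟩
  have h1 := mul_le_mul_of_nonneg_left (hf.le_legendre (z / T) M) hT.le
  have h2 := mul_le_mul_of_nonneg_left (hf.le_legendre (z / T) (-M)) hT.le
  have h3 := mul_le_mul_of_nonneg_left (le_max_left (f M) (f (-M))) hT.le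
  have h4 := mul_le_mul_of_nonneg_left (le_max_right (f M) (f (-M))) hT.le
  have h5 : T * (z / T * M - f M) = z * M - T * f M := by field_simp
  have h6 : T * (z / T * -M - f (-M)) = -(z * M) - T * f (-M) := by field_simp
  rcases abs_cases z with ⟨h, -⟩ | ⟨h, -⟩ <;> rw [h] <;> linarith

lemma exists_isLeast_hopfLax (hf : CondF f) {T : ℝ} (hT : 0 < T) {a b : ℝ} {U : ℝ → ℝ}
    (hU : SlopeBetween a b U) (x : ℝ) :
    ∃ ξ, IsLeast (Set.range fun ξ => U ξ + T * legendre f ((x - ξ) / T))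
      (U ξ + T * legendre f ((x - ξ) / T)) := by
  obtain ⟨ξ, hξ⟩ := hU.exists_min (hf.continuous_cost hT) (hf.cost_coercive hT) x
  exact ⟨ξ, ⟨ξ, rfl⟩, by rintro _ ⟨η, rfl⟩; exact hξ η⟩

lemma exists_hopfLax_eq (hf : CondF f) {T : ℝ} (hT : 0 < T) {a b : ℝ} {U : ℝ → ℝ}
    (hU : SlopeBetween a b U) (x : ℝ) :
    ∃ ξ, HopfLax f T U x = U ξ + T * legendre f ((x - ξ) / T) :=
  let ⟨ξ, hξ⟩ := hf.exists_isLeast_hopfLax hT hU x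
  ⟨ξ, hξ.csInf_eq⟩

lemma hopfLax_le (hf : CondF f) {T : ℝ} (hT : 0 < T) {a b : ℝ} {U : ℝ → ℝ}
    (hU : SlopeBetween a b U) (x ξ : ℝ) :
    HopfLax f T U x ≤ U ξ + T * legendre f ((x - ξ) / T) :=
  let ⟨_, hη⟩ := hf.exists_isLeast_hopfLax hT hU x
  csInf_le ⟨_, hη.2⟩ ⟨ξ, rfl⟩

lemma slopeBetween_hopfLax (hf : CondF f) {T : ℝ} (hT : 0 < T) {a b : ℝ} {U : ℝ → ℝ}
    (hU : SlopeBetween a b U) : SlopeBetween a b (HopfLax f T U) :=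
  hU.of_attained (c := fun z => T * legendre f (z / T)) (hf.hopfLax_le hT hU)
    (hf.exists_hopfLax_eq hT hU)

lemma exists_isGreatest_Uflat (hf : CondF f) {T : ℝ} (hT : 0 < T) {a b : ℝ} {u : ℝ → ℝ} {xc : ℝ}
    (hU : SlopeBetween a b (UT u xc)) (x : ℝ) :
    ∃ ξ, IsGreatest (Set.range fun ξ => UT u xc ξ - T * legendre f ((ξ - x) / T))
      (UT u xc ξ - T * legendre f ((ξ - x) / T)) := by
  obtain ⟨ξ, hξ⟩ := hU.neg.exists_min (c := fun z => T * legendre f (-z / T))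
    ((hf.continuous_cost hT).comp continuous_neg)
    (fun M => (hf.cost_coercive hT M).imp fun C hC z => by simpa using hC (-z)) x
  refine ⟨ξ, ⟨ξ, rfl⟩, ?_⟩
  rintro _ ⟨η, rfl⟩
  have := hξ η
  simp only [neg_sub] at this ⊢
  linarith

lemma exists_Uflat_eq (hf : CondF f) {T : ℝ} (hT : 0 < T) {a b : ℝ} {u : ℝ → ℝ} {xc : ℝ}
    (hU : SlopeBetween a b (UT u xc)) (x : ℝ) :
    ∃ ξ, Uflat f T u xc x = UT u xc ξ - T * legendre f ((ξ - x) / T) :=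
  let ⟨ξ, hξ⟩ := hf.exists_isGreatest_Uflat hT hU x
  ⟨ξ, hξ.csSup_eq⟩

lemma le_Uflat (hf : CondF f) {T : ℝ} (hT : 0 < T) {a b : ℝ} {u : ℝ → ℝ} {xc : ℝ}
    (hU : SlopeBetween a b (UT u xc)) (x ξ : ℝ) :
    UT u xc ξ - T * legendre f ((ξ - x) / T) ≤ Uflat f T u xc x :=
  let ⟨_, hη⟩ := hf.exists_isGreatest_Uflat hT hU x
  le_csSup ⟨_, hη.2⟩ ⟨ξ, rfl⟩

lemma slopeBetween_Uflat (hf : CondF f) {T : ℝ} (hT : 0 < T) {a b : ℝ} {u : ℝ → ℝ} {xc : ℝ}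
    (hU : SlopeBetween a b (UT u xc)) : SlopeBetween a b (Uflat f T u xc) := by
  have h : SlopeBetween (-b) (-a) (fun x => -Uflat f T u xc x) := by
    refine hU.neg.of_attained (c := fun z => T * legendre f (-z / T)) (fun x ξ => ?_) fun x => ?_
    · have := hf.le_Uflat hT hU x ξ
      simp only [neg_sub]
      linarith
    · obtain ⟨ξ, hξ⟩ := hf.exists_Uflat_eq hT hU x
      refine ⟨ξ, ?_⟩
      simp only [neg_sub]
      linarith
  simpa only [neg_neg] using h.neg

/-- Under the Oleinik condition, `x` maximizes `U_T - T f*((· - ξ) / T)` for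
`ξ = x - T f'(u_T(x))`. -/
lemma UT_sub_cost_le (hf : CondF f) {T : ℝ} (hT : 0 < T) {u : ℝ → ℝ}
    (hu : ∀ x y, IntervalIntegrable u volume x y) (hO : Oleinik f T u) (xc x y : ℝ) :
    UT u xc y - T * legendre f ((y - (x - T * deriv f (u x))) / T) ≤
      UT u xc x - T * legendre f ((x - (x - T * deriv f (u x))) / T) := by
  set ξ := x - T * deriv f (u x) with hξ
  have hdiv : ∀ t, (t - ξ) / T = deriv f (u x) + (t - x) / T := fun t => by
    rw [hξ]
    field_simp
    ring
  have hgc : Continuous fun t => hf.derivEquiv.symm ((t - ξ) / T) :=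
    hf.derivEquiv.symm.continuous.comp (by fun_prop)
  have hftc : ∀ s t, ∫ r in s..t, hf.derivEquiv.symm ((r - ξ) / T) =
      T * legendre f ((t - ξ) / T) - T * legendre f ((s - ξ) / T) := fun s t =>
    intervalIntegral.integral_eq_sub_of_hasDerivAt
      (fun r _ => by simpa using (hf.hasDerivAt_cost hT (r - ξ)).comp_sub_const r ξ)
      (hgc.intervalIntegrable _ _)
  rcases le_total x y with h | h
  · have hmono : ∫ t in x..y, u t ≤ ∫ t in x..y, hf.derivEquiv.symm ((t - ξ) / T) := by
      refine intervalIntegral.integral_mono_on h (hu _ _) (hgc.intervalIntegrable _ _)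
        fun t ht => ?_
      rw [OrderIso.le_symm_apply, derivEquiv_apply, hdiv]
      rcases ht.1.eq_or_lt with rfl | hlt
      · simp
      · have := hO x (t - x) (sub_pos.2 hlt)
        rw [add_sub_cancel] at this
        linarith
    rw [← UT_sub hu xc, hftc] at hmono
    linarith
  · have hmono : ∫ t in y..x, hf.derivEquiv.symm ((t - ξ) / T) ≤ ∫ t in y..x, u t := by
      refine intervalIntegral.integral_mono_on h (hgc.intervalIntegrable _ _) (hu _ _)
        fun t ht => ?_
      rw [OrderIso.symm_apply_le, derivEquiv_apply, hdiv]
      rcases ht.2.eq_or_lt with rfl | hlt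
      · simp
      · have := hO t (x - t) (sub_pos.2 hlt)
        rw [add_sub_cancel, ← neg_sub t x, neg_div] at this
        linarith
    rw [← UT_sub hu xc, hftc] at hmono
    linarith

/-- At a differentiability point of `V`, the minimizer of the Hopf–Lax formula is the foot of the
characteristic. -/
lemma foot_eq (hf : CondF f) {T : ℝ} (hT : 0 < T) {V : ℝ → ℝ} {x ξ m : ℝ}
    (hV : DifferentiableAt ℝ V x) (hle : ∀ y, V y ≤ m + T * legendre f ((y - ξ) / T))
    (heq : V x = m + T * legendre f ((x - ξ) / T)) : ξ = x - T * deriv f (deriv V x) := by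
  have hd := ((hf.hasDerivAt_cost hT (x - ξ)).comp_sub_const x ξ).sub hV.hasDerivAt
  have hmin : IsLocalMin ((fun y => T * legendre f ((y - ξ) / T)) - V) x :=
    Eventually.of_forall fun y => by
      have := hle y
      simp only [Pi.sub_apply]
      linarith
  have h0 := sub_eq_zero.1 (hmin.hasDerivAt_eq_zero hd)
  rw [← h0, hf.deriv_derivEquiv_symm]
  field_simp
  ring

end CondF

theorem stmt_16 (f : ℝ → ℝ) (hf : CondF f) (T : ℝ) (hT : 0 < T)
    (J : Set ℝ) (hJne : J.Nonempty) (hJcp : IsCompact J) (hJoc : J.OrdConnected)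
    (uT : ℝ → ℝ) (huT : Measurable uT)
    (hlc : LeftCts uT) (huTJ : ∀ x, uT x ∈ J) (hO : Oleinik f T uT) (xc : ℝ) :
    IIT f T uT xc J =
      {U : ℝ → ℝ | (∃ K, LipschitzWith K U) ∧
        ∀ᵐ x ∂volume, deriv U x ∈ J ∧
          U x ∈ Set.Icc (Uflat f T uT xc x) (Usharp f T uT xc J x)} := by
  set a := sInf J
  set b := sSup J
  have hJ : J = Set.Icc a b := eq_Icc_of_connected_compact ⟨hJne, hJoc.isPreconnected⟩ hJcp
  have huI : ∀ x, uT x ∈ Set.Icc a b := fun x => hJ ▸ huTJ x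
  have hint := intervalIntegrable_of_mem_Icc huT huI
  have hUT : SlopeBetween a b (UT uT xc) := slopeBetween_UT huT huI xc
  have hslope : ∀ U : ℝ → ℝ, (∃ K, LipschitzWith K U) → (∀ᵐ x, deriv U x ∈ J) →
      SlopeBetween a b U := fun U ⟨_, hK⟩ hd => .of_ae_deriv hK (hJ ▸ hd)
  have hIIT : ∀ U ∈ IIT f T uT xc J, SlopeBetween a b U := fun U hU => hslope U hU.1 hU.2.1
  have hflat : SlopeBetween a b (Uflat f T uT xc) := hf.slopeBetween_Uflat hT hUT
  have hge : ∀ U : ℝ → ℝ, SlopeBetween a b U → (∀ x, Uflat f T uT xc x ≤ U x) →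
      ∀ x, UT uT xc x ≤ HopfLax f T U x := fun U hU hle x => by
    obtain ⟨ξ, hξ⟩ := hf.exists_hopfLax_eq hT hU x
    have := hf.le_Uflat hT hUT ξ x
    have := hle ξ
    linarith
  have hne : (IIT f T uT xc J).Nonempty := by
    refine ⟨Uflat f T uT xc, hflat.lipschitzWith, ?_, fun x => ?_⟩
    · obtain ⟨K, hK⟩ := hflat.lipschitzWith
      filter_upwards [hK.ae_differentiableAt_real] with x hx
      rw [hJ]
      exact hflat.deriv_mem_Icc hx
    · refine le_antisymm ?_ (hge _ hflat (fun _ => le_rfl) x)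
      obtain ⟨η, hη⟩ := hf.exists_Uflat_eq hT hUT (x - T * deriv f (uT x))
      have h1 := hf.UT_sub_cost_le hT hint hO xc x η
      have h2 := hf.hopfLax_le hT hflat x (x - T * deriv f (uT x))
      linarith
  have hbdd : ∀ x, BddAbove ((fun U : ℝ → ℝ => U x) '' IIT f T uT xc J) := fun x => by
    obtain ⟨C, hC⟩ := hf.cost_coercive hT (max |a| |b|)
    refine ⟨UT uT xc x + C, ?_⟩
    rintro _ ⟨U, hU, rfl⟩
    obtain ⟨ξ, hξ⟩ := hf.exists_hopfLax_eq hT (hIIT U hU) x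
    rw [hU.2.2 x] at hξ
    have h1 := (abs_le.1 ((hIIT U hU).abs_sub_le x ξ)).2
    have h2 := hC (x - ξ)
    simp only
    linarith
  have hsharp : SlopeBetween a b (Usharp f T uT xc J) := .sSup_image hne hIIT hbdd
  ext U
  constructor
  · intro hU
    refine ⟨hU.1, hU.2.1.mono fun x hx => ⟨hx, ?_, le_csSup (hbdd x) (Set.mem_image_of_mem _ hU)⟩⟩
    obtain ⟨ξ, hξ⟩ := hf.exists_Uflat_eq hT hUT x
    have := hf.hopfLax_le hT (hIIT U hU) ξ x
    rw [hU.2.2 ξ] at this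
    linarith
  · rintro ⟨hL, hae⟩
    have hd : ∀ᵐ x, deriv U x ∈ J := hae.mono fun x hx => hx.1
    have hU := hslope U hL hd
    have hall : ∀ x, U x ∈ Set.Icc (Uflat f T uT xc x) (Usharp f T uT xc J x) := by
      have hcl : IsClosed {x | U x ∈ Set.Icc (Uflat f T uT xc x) (Usharp f T uT xc J x)} :=
        (isClosed_le hflat.continuous hU.continuous).inter
          (isClosed_le hU.continuous hsharp.continuous)
      have hdense := Measure.dense_of_ae (hae.mono fun x hx => hx.2)
      exact fun x => hcl.closure_subset (hdense x)
    refine ⟨hL, hd, fun x => le_antisymm ?_ (hge U hU (fun x => (hall x).1) x)⟩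
    obtain ⟨K, hK⟩ := hUT.lipschitzWith
    have hcl : IsClosed {x | HopfLax f T U x ≤ UT uT xc x} :=
      isClosed_le (hf.slopeBetween_hopfLax hT hU).continuous hUT.continuous
    refine hcl.closure_subset ((Measure.dense_of_ae (hK.ae_differentiableAt_real.mono
      fun y hy => ?_)) x)
    set ζ := y - T * deriv f (deriv (UT uT xc) y)
    have hle : Usharp f T uT xc J ζ ≤ UT uT xc y - T * legendre f ((y - ζ) / T) := by
      refine csSup_le (hne.image _) ?_
      rintro _ ⟨W, hW, rfl⟩
      obtain ⟨ξ, hξ⟩ := hf.exists_hopfLax_eq hT (hIIT W hW) y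
      rw [hW.2.2 y] at hξ
      have hfoot : ξ = ζ := hf.foot_eq hT hy
        (fun z => hW.2.2 z ▸ hf.hopfLax_le hT (hIIT W hW) z ξ) hξ
      rw [hfoot] at hξ
      simp only
      linarith
    have h1 := (hall ζ).2
    have h2 := hf.hopfLax_le hT hU y ζ
    linarith
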